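/- Let k be a field of odd characteristic ℓ, let n ≥ 1 be an integer, set Q = 2^{2n+1} and P = 2^{n+1} (so that Q = q² and P = √2·q for q = √(2^{2n+1})), and for ε ∈ {−1, 0, 1} set c_ε = Q + εP + 1 (so c₀ = Q+1). Assume ℓ divides (Q−1)(Q+1)(Q+P+1)(Q−P+1). Consider the 2×2 matrices over k given by the images of the integer matrices A_ε = [[Q, 0],[c_ε, −1]] and B = [[−1, Q],[0, Q²]]. Then A_ε and B have a common eigenvector in k² (equivalently, the k-subalgebra of 2×2 matrices generated by A_ε and B acts reducibly on k²) if and only if ℓ divides c_ε. -/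

import Mathlib

namespace Ree2F4Hecke

/-- `Q = q² = 2^(2n+1)` as an integer. -/
def Qz (n : ℕ) : ℤ := 2 ^ (2 * n + 1)

/-- `P = √2·q = 2^(n+1)` as an integer. -/
def Pz (n : ℕ) : ℤ := 2 ^ (n + 1)

/-- `c_ε = Q + ε·P + 1`. -/
def cz (n : ℕ) (ε : ℤ) : ℤ := Qz n + ε * Pz n + 1

/-- The image over `k` of the integer matrix `A_ε = [[Q, 0], [c_ε, −1]]`
(the image of `T_a` under the `2`-dimensional Hecke algebra representation `S_ε`). -/
def Amat (k : Type*) [Field k] (n : ℕ) (ε : ℤ) : Matrix (Fin 2) (Fin 2) k :=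
  !![((Qz n : ℤ) : k), 0; ((cz n ε : ℤ) : k), -1]

/-- The image over `k` of the integer matrix `B = [[−1, Q], [0, Q²]]`
(the image of `T_b` under the representation `S_ε`). -/
def Bmat (k : Type*) [Field k] (n : ℕ) : Matrix (Fin 2) (Fin 2) k :=
  !![(-1 : k), ((Qz n : ℤ) : k); 0, ((Qz n ^ 2 : ℤ) : k)]

/-- The field identity behind the criterion: a common eigenvector with both coordinates nonzero
forces `q * c = (q + 1) * (q ^ 2 + 1)`, which together with `q ^ 4 = 1` forces `c = 0`. -/
lemma eq_zero_of_mul_eq {k : Type*} [Field k] {q p e c : k} (hq : q ≠ 0)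
    (hp : p ^ 2 = 2 * q) (he : e = -1 ∨ e = 0 ∨ e = 1) (hc : c = q + e * p + 1)
    (hq4 : q ^ 4 = 1) (h : q * c = (q + 1) * (q ^ 2 + 1)) : c = 0 := by
  have hfactor : (q - 1) * ((q + 1) * (q ^ 2 + 1)) = 0 := by linear_combination hq4
  rcases mul_eq_zero.1 hfactor with hq1 | hqc
  · obtain rfl : q = 1 := sub_eq_zero.1 hq1
    -- Here `e * p = 2`, while `p ^ 2 = 2`.
    have hep : e * p = 2 := by linear_combination h - hc
    rcases he with rfl | rfl | rfl
    · have h2 : (2 : k) = 0 := by linear_combination hp - (p - 2) * (-hep)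
      linear_combination hc + hep + 2 * h2
    · linear_combination hc - hep
    · have h2 : (2 : k) = 0 := by linear_combination hp - (p + 2) * hep
      linear_combination hc + hep + 2 * h2
  · exact (mul_eq_zero.1 (h.trans hqc)).resolve_left hq

/-- **Reducibility criterion for the two-dimensional Hecke algebra representations
`S_ε` of `²F₄(2^(2n+1))` in characteristic `ℓ`.**
Let `k` be a field of odd prime characteristic `ℓ`, let `n ≥ 1`, `Q = 2^(2n+1)`,
`P = 2^(n+1)`, and for `ε ∈ {−1, 0, 1}` set `c_ε = Q + ε·P + 1`.  Assume `ℓ` divides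
`(Q−1)(Q+1)(Q+P+1)(Q−P+1)`.  Then the reductions of `A_ε` and `B` have a common
eigenvector in `k²` (equivalently, the subalgebra they generate acts reducibly on `k²`)
if and only if `ℓ` divides `c_ε`. -/
theorem common_eigenvector_iff_char_dvd
    (k : Type*) [Field k] (ℓ : ℕ) (hℓ : Nat.Prime ℓ) (hodd : Odd ℓ) [CharP k ℓ]
    (n : ℕ) (hn : 1 ≤ n) (ε : ℤ) (hε : ε ∈ ({-1, 0, 1} : Set ℤ))
    (hdvd : (ℓ : ℤ) ∣ (Qz n - 1) * (Qz n + 1) * (Qz n + Pz n + 1) * (Qz n - Pz n + 1)) :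
    (∃ v : Fin 2 → k, v ≠ 0 ∧
        (∃ α : k, (Amat k n ε).mulVec v = α • v) ∧
        (∃ β : k, (Bmat k n).mulVec v = β • v)) ↔
      (ℓ : ℤ) ∣ cz n ε := by
  have h2 : (2 : k) ≠ 0 := by
    have h := (CharP.cast_eq_zero_iff k ℓ 2).not.2 fun h => by
      obtain rfl := (Nat.prime_dvd_prime_iff_eq hℓ Nat.prime_two).1 h
      exact absurd hodd (by decide)
    exact_mod_cast h
  have hQ : (Qz n : k) ≠ 0 := by simp [Qz, h2]
  have hPQ : (Pz n : k) ^ 2 = 2 * Qz n := by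
    simp only [Pz, Qz]
    push_cast
    ring
  rw [← CharP.intCast_eq_zero_iff k ℓ] at hdvd ⊢
  push_cast at hdvd
  constructor
  · rintro ⟨v, hv, ⟨α, hα⟩, β, hβ⟩
    have hA0 := congrFun hα 0
    have hA1 := congrFun hα 1
    have hB0 := congrFun hβ 0
    have hB1 := congrFun hβ 1
    simp only [Amat, Bmat, Matrix.mulVec, dotProduct, Fin.sum_univ_two, Matrix.of_apply,
      Matrix.cons_val_zero, Matrix.cons_val_one, Pi.smul_apply, smul_eq_mul, Int.cast_pow]
      at hA0 hA1 hB0 hB1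
    have hx : v 0 ≠ 0 := fun hx => by
      have hy : v 1 = 0 := by simpa [hx, hQ] using hB0
      exact hv (by ext i; fin_cases i <;> assumption)
    obtain rfl : (Qz n : k) = α := mul_right_cancel₀ hx (by linear_combination hA0)
    by_cases hy : v 1 = 0
    · simpa [hy, hx] using hA1
    · obtain rfl : (Qz n : k) ^ 2 = β := mul_right_cancel₀ hy (by linear_combination hB1)
      refine eq_zero_of_mul_eq hQ hPQ (e := (ε : k)) ?_ (by simp [cz]) ?_ ?_
      · rcases hε with rfl | rfl | rfl <;> simp
      · linear_combination hdvd + ((Qz n : k) ^ 2 - 1) * hPQ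
      · refine mul_right_cancel₀ hx ?_
        linear_combination (Qz n : k) * hA1 + ((Qz n : k) + 1) * hB0
  · intro hc
    refine ⟨![1, 0], fun h => one_ne_zero (congrFun h 0), ⟨Qz n, ?_⟩, -1, ?_⟩
    · ext i
      fin_cases i <;> simp [Amat, hc]
    · ext i
      fin_cases i <;> simp [Bmat]

end Ree2F4Hecke
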